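/- arXiv:1912.07825 — 3 statements merged into one kernel-verified Lean document; each statement's English description precedes it below -/
import Mathlib

section
/- Let ψ : ℝ → ℝ be integrable with 0 ≤ ψ(x) ≤ Λ for all x, where Λ ≥ 0 is a constant, and let T > 0. Define ψ_T(x) := ∫_{-T}^{T} ψ(x+τ) dτ. Then for all real numbers τ ≤ t with t − τ ≥ 2T one has ∫_τ^t ψ(s) ds ≥ (1/(2T)) ∫_τ^t ψ_T(s) ds − 2TΛ. -/
open MeasureTheory intervalIntegral

theorem integrableOn_comp_add_uIoc_prod {ψ : ℝ → ℝ} (hψ : AEStronglyMeasurable ψ) {C : ℝ}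
    (hC : ∀ x, ‖ψ x‖ ≤ C) (a b c d : ℝ) :
    IntegrableOn (Function.uncurry fun s u => ψ (s + u)) (Set.uIoc a b ×ˢ Set.uIoc c d) := by
  have hmeas : AEStronglyMeasurable (Function.uncurry fun s u => ψ (s + u)) :=
    hψ.comp_quasiMeasurePreserving
      (quasiMeasurePreserving_add (volume : Measure ℝ) (volume : Measure ℝ))
  refine Measure.integrableOn_of_bounded (M := C) ?_ hmeas (.of_forall fun p => hC _)
  rw [Measure.volume_eq_prod, Measure.prod_prod]
  exact ENNReal.mul_ne_top (by simp [Set.uIoc]) (by simp [Set.uIoc])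

theorem intervalIntegral_add_right_sub_le {ψ : ℝ → ℝ} (hψ : Integrable ψ) {C : ℝ}
    (hC : ∀ x, ‖ψ x‖ ≤ C) (a b u : ℝ) :
    (∫ s in (a + u)..(b + u), ψ s) - (∫ s in a..b, ψ s) ≤ 2 * |u| * C := by
  have hi : ∀ p q : ℝ, IntervalIntegrable ψ volume p q := fun _ _ => hψ.intervalIntegrable
  have hbound : ∀ p : ℝ, |∫ s in p..(p + u), ψ s| ≤ C * |u| := fun p => by
    simpa using norm_integral_le_of_norm_le_const (a := p) (b := p + u) fun x _ => hC x
  rw [integral_interval_sub_interval_comm' (hi _ _) (hi _ _) (hi _ _)]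
  linarith [(abs_le.mp (hbound b)).2, (abs_le.mp (hbound a)).1,
    integral_symm (μ := volume) (f := ψ) a (a + u)]

theorem continuous_intervalIntegral_add_right {ψ : ℝ → ℝ} (hψ : Integrable ψ) (a b : ℝ) :
    Continuous fun u => ∫ s in (a + u)..(b + u), ψ s := by
  have hi : ∀ p q : ℝ, IntervalIntegrable ψ volume p q := fun _ _ => hψ.intervalIntegrable
  have hP : Continuous fun x => ∫ s in (0 : ℝ)..x, ψ s := continuous_primitive hi 0
  simp_rw [← fun u => integral_interval_sub_left (hi 0 (b + u)) (hi 0 (a + u))]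
  exact (hP.comp (continuous_const.add continuous_id)).sub
    (hP.comp (continuous_const.add continuous_id))

/-- For `ψ : ℝ → ℝ` integrable with `0 ≤ ψ ≤ Λ` and `T > 0`, setting
`ψ_T x = ∫ u in -T..T, ψ (x + u)`, for all `τ ≤ t` with `t - τ ≥ 2T` we have
`∫ s in τ..t, ψ s ≥ (1/(2T)) * ∫ s in τ..t, ψ_T s - 2TΛ`. -/
theorem window_average_lower_bound (ψ : ℝ → ℝ) (hψ : Integrable ψ)
    (Λ : ℝ) (hΛ : 0 ≤ Λ) (hψ0 : ∀ x, 0 ≤ ψ x) (hψΛ : ∀ x, ψ x ≤ Λ)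
    (T : ℝ) (hT : 0 < T) (τ t : ℝ) (hτt : τ ≤ t) (hgap : 2 * T ≤ t - τ) :
    (∫ s in τ..t, ψ s) ≥
      (1 / (2 * T)) * (∫ s in τ..t, ∫ u in (-T)..T, ψ (s + u)) - 2 * T * Λ := by
  have hC : ∀ x, ‖ψ x‖ ≤ Λ := fun x => by
    simpa [abs_of_nonneg (hψ0 x)] using hψΛ x
  have hle : (∫ u in (-T)..T, ∫ s in (τ + u)..(t + u), ψ s) ≤
      ∫ _u in (-T)..T, ((∫ s in τ..t, ψ s) + 2 * T * Λ) := by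
    refine integral_mono_on (by linarith)
      ((continuous_intervalIntegral_add_right hψ τ t).intervalIntegrable _ _)
      intervalIntegrable_const fun u hu => ?_
    have hshift := intervalIntegral_add_right_sub_le hψ hC τ t u
    have hu : |u| ≤ T := abs_le.mpr hu
    have : 2 * |u| * Λ ≤ 2 * T * Λ := by gcongr
    linarith
  have hswap : (∫ s in τ..t, ∫ u in (-T)..T, ψ (s + u)) =
      ∫ u in (-T)..T, ∫ s in (τ + u)..(t + u), ψ s := by
    rw [intervalIntegral_intervalIntegral_swap
      (integrableOn_comp_add_uIoc_prod hψ.aestronglyMeasurable hC _ _ _ _)]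
    simp_rw [integral_comp_add_right]
  rw [hswap, ge_iff_le, sub_le_iff_le_add, one_div, inv_mul_le_iff₀ (by positivity)]
  refine hle.trans_eq ?_
  rw [intervalIntegral.integral_const, smul_eq_mul]
  ring
end

section
/- Let E be a real inner product space and let D : ℝ → (E →L[ℝ] E) be a continuously differentiable curve of continuous linear endomorphisms of E such that D(t) is invertible for every t ∈ ℝ. Fix w ∈ E with w ≠ 0, so that D(t)w ≠ 0 for all t. Set U(t) := D'(t) ∘ D(t)⁻¹ and Y(t) := D(t)w / ‖D(t)w‖. Then for all real numbers a ≤ b, ‖D(b)w‖ = ‖D(a)w‖ · exp( ∫_a^b ⟨U(t)(Y(t)), Y(t)⟩ dt ). -/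
open MeasureTheory intervalIntegral
open scoped RealInnerProductSpace

/-- A nowhere vanishing curve `f` satisfies `(log ‖f‖)' = ⟪f', f⟫ / ‖f‖²`. -/
theorem HasDerivAt.log_norm {E : Type*} [NormedAddCommGroup E] [InnerProductSpace ℝ E]
    {f : ℝ → E} {f' : E} {t : ℝ} (hf : HasDerivAt f f' t) (h0 : f t ≠ 0) :
    HasDerivAt (fun s => Real.log ‖f s‖) (⟪f', f t⟫ / ‖f t‖ ^ 2) t := by
  have hlog := (hf.norm_sq.log (pow_ne_zero 2 (norm_ne_zero_iff.mpr h0))).div_const 2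
  have hfun : (fun s => Real.log (‖f s‖ ^ 2) / 2) = fun s => Real.log ‖f s‖ := by
    ext s
    simp [Real.log_pow]
  have hval : 2 * ⟪f t, f'⟫ / ‖f t‖ ^ 2 / 2 = ⟪f', f t⟫ / ‖f t‖ ^ 2 := by
    rw [real_inner_comm]
    ring
  rwa [hfun, hval] at hlog

/-- The norm of a nowhere vanishing `C¹` curve is the exponential of the integral of its
logarithmic derivative. -/
theorem norm_eq_norm_mul_exp_integral {E : Type*} [NormedAddCommGroup E] [InnerProductSpace ℝ E]
    {f f' : ℝ → E} (hf : ∀ t, HasDerivAt f (f' t) t) (hf' : Continuous f') (h0 : ∀ t, f t ≠ 0)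
    (a b : ℝ) :
    ‖f b‖ = ‖f a‖ * Real.exp (∫ t in a..b, ⟪f' t, f t⟫ / ‖f t‖ ^ 2) := by
  have hcf : Continuous f := continuous_iff_continuousAt.mpr fun t => (hf t).continuousAt
  have hc : Continuous fun t => ⟪f' t, f t⟫ / ‖f t‖ ^ 2 :=
    (hf'.inner hcf).div (hcf.norm.pow 2) fun t => pow_ne_zero 2 (norm_ne_zero_iff.mpr (h0 t))
  rw [integral_eq_sub_of_hasDerivAt (fun t _ => (hf t).log_norm (h0 t))
      (hc.intervalIntegrable a b), Real.exp_sub, Real.exp_log (norm_pos_iff.mpr (h0 b)),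
    Real.exp_log (norm_pos_iff.mpr (h0 a)), mul_div_cancel₀ _ (norm_ne_zero_iff.mpr (h0 a))]

/-- **Norm growth formula for Jacobi tensors.** Let `D : ℝ → (E →L[ℝ] E)` be a `C¹`
curve of invertible continuous linear endomorphisms of a real inner product space `E`,
with (two-sided) inverse `Dinv`. Fix `w ≠ 0`, and set `U t = (deriv D t) ∘ (D t)⁻¹`
and `Y t = D t w / ‖D t w‖`. Then for all `a ≤ b`,
`‖D b w‖ = ‖D a w‖ * exp (∫ t in a..b, ⟪U t (Y t), Y t⟫)`. -/
theorem jacobi_tensor_norm_growth {E : Type*} [NormedAddCommGroup E] [InnerProductSpace ℝ E]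
    (D Dinv : ℝ → (E →L[ℝ] E)) (hD : ContDiff ℝ 1 D)
    (hinv₁ : ∀ t, (D t).comp (Dinv t) = ContinuousLinearMap.id ℝ E)
    (hinv₂ : ∀ t, (Dinv t).comp (D t) = ContinuousLinearMap.id ℝ E)
    (w : E) (hw : w ≠ 0) (a b : ℝ) (hab : a ≤ b) :
    ‖(D b) w‖ = ‖(D a) w‖ * Real.exp (∫ t in a..b,
      ⟪((deriv D t).comp (Dinv t)) (‖(D t) w‖⁻¹ • (D t) w), ‖(D t) w‖⁻¹ • (D t) w⟫) := by
  have hleft (t : ℝ) (x : E) : Dinv t (D t x) = x := DFunLike.congr_fun (hinv₂ t) x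
  have h0 (t : ℝ) : D t w ≠ 0 := fun h => hw (by rw [← hleft t w, h, map_zero])
  have hderiv (t : ℝ) : HasDerivAt (fun s => D s w) (deriv D t w) t :=
    (ContinuousLinearMap.apply ℝ E w).hasFDerivAt.comp_hasDerivAt t
      (hD.differentiable one_ne_zero t).hasDerivAt
  have hcont : Continuous fun t => deriv D t w :=
    (hD.continuous_deriv le_rfl).clm_apply continuous_const
  rw [norm_eq_norm_mul_exp_integral hderiv hcont h0 a b]
  congr 3 with t
  simp only [ContinuousLinearMap.comp_apply, map_smul, hleft, real_inner_smul_left,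
    real_inner_smul_right]
  ring
end

section
/- Let X be a topological space, (f_t)_{t∈ℝ} a continuous flow on X, λ : X → ℝ a continuous nonnegative function, and η > 0. For x ∈ X and t ≥ 0 say (x,t) ∈ B(η) if ∫_0^t λ(f_s x) ds ≤ η t, and say (x,t) ∈ G(η) if for every τ ∈ [0,t] both ∫_0^τ λ(f_s x) ds ≥ η τ and ∫_0^τ λ(f_{t-s} x) ds ≥ η τ. Then for every x ∈ X and t ≥ 0 there exist p, g, s ≥ 0 with p + g + s = t such that (x, p) ∈ B(η), (f_p x, g) ∈ G(η), and (f_{p+g} x, s) ∈ B(η). -/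
open MeasureTheory intervalIntegral

/-- **λ-decomposition of orbit segments (Call–Thompson).** Let `(f_t)` be a continuous
flow on `X`, `lam : X → ℝ` continuous and nonnegative, and `η > 0`. Then every orbit
segment `(x, t)` with `t ≥ 0` decomposes as `t = p + g + s` where the initial segment of
length `p` has small average (`(x, p) ∈ B(η)`), the middle segment of length `g` is good
(`(f_p x, g) ∈ G(η)`), and the terminal segment of length `s` has small average
(`(f_{p+g} x, s) ∈ B(η)`). -/
theorem lambda_decomposition {X : Type*} [TopologicalSpace X]
    (f : ℝ → X → X) (hf : Continuous fun p : ℝ × X => f p.1 p.2)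
    (hf0 : ∀ x, f 0 x = x) (hfadd : ∀ t s x, f (t + s) x = f t (f s x))
    (lam : X → ℝ) (hlam : Continuous lam) (hlam0 : ∀ x, 0 ≤ lam x)
    (η : ℝ) (hη : 0 < η) (x : X) (t : ℝ) (ht : 0 ≤ t) :
    ∃ p g s : ℝ, 0 ≤ p ∧ 0 ≤ g ∧ 0 ≤ s ∧ p + g + s = t ∧
      (∫ u in (0:ℝ)..p, lam (f u x)) ≤ η * p ∧
      (∀ τ ∈ Set.Icc (0:ℝ) g,
        η * τ ≤ (∫ u in (0:ℝ)..τ, lam (f u (f p x))) ∧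
        η * τ ≤ (∫ u in (0:ℝ)..τ, lam (f (g - u) (f p x)))) ∧
      (∫ u in (0:ℝ)..s, lam (f u (f (p + g) x))) ≤ η * s := by
  set h : ℝ → ℝ := fun u => lam (f u x) with h_def
  have h_cont : Continuous h :=
    hlam.comp (hf.comp (continuous_id.prodMk continuous_const))
  have h_int : ∀ a b, IntervalIntegrable h volume a b := fun a b =>
    h_cont.intervalIntegrable a b
  set F : ℝ → ℝ := fun u => (∫ v in (0:ℝ)..u, h v) - η * u with F_def
  have F_cont : Continuous F :=
    (continuous_primitive h_int 0).sub (continuous_const.mul continuous_id)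
  have F_sub : ∀ a b, ∫ u in a..b, h u = F b - F a + η * (b - a) := by
    intro a b
    rw [← integral_interval_sub_left (h_int 0 b) (h_int 0 a)]
    simp only [F_def]
    ring
  obtain ⟨p, ⟨hp0, hpt⟩, hp⟩ := isCompact_Icc.exists_isMinOn
    (Set.nonempty_Icc.mpr ht) F_cont.continuousOn
  obtain ⟨q, ⟨hpq, hqt⟩, hq⟩ := isCompact_Icc.exists_isMaxOn
    (Set.nonempty_Icc.mpr hpt) F_cont.continuousOn
  have h_forward : ∀ a τ, ∫ u in (0:ℝ)..τ, lam (f u (f a x)) =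
      F (a + τ) - F a + η * τ := by
    intro a τ
    simp only [← hfadd]
    rw [integral_comp_add_right h, F_sub, zero_add, add_comm τ a]
    ring
  have h_backward : ∀ τ, ∫ u in (0:ℝ)..τ, lam (f (q - p - u) (f p x)) =
      F q - F (q - τ) + η * τ := by
    intro τ
    have h_eq : ∀ u, q - p - u + p = q - u := fun u => by ring
    simp only [← hfadd, h_eq]
    rw [integral_comp_sub_left h, F_sub, sub_zero]
    ring
  refine ⟨p, q - p, t - q, hp0, sub_nonneg.mpr hpq, sub_nonneg.mpr hqt, by ring, ?_, ?_, ?_⟩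
  · have h_min : F p ≤ F 0 := hp ⟨le_rfl, ht⟩
    have h_val := F_sub 0 p
    linarith
  · rintro τ ⟨hτ0, hτ⟩
    have h_min : F p ≤ F (p + τ) := hp ⟨by linarith, by linarith⟩
    have h_max : F (q - τ) ≤ F q := hq ⟨by linarith, by linarith⟩
    rw [h_forward, h_backward]
    constructor <;> linarith
  · have h_max : F t ≤ F q := hq ⟨hpt, le_rfl⟩
    rw [add_sub_cancel, h_forward, add_sub_cancel]
    linarith
end
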